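/- arXiv:2212.10966 — 6 statements merged into one kernel-verified Lean document; each statement's English description precedes it below -/
import Mathlib

section
/- Let n ≥ 1 and let A ∈ ℂ^{n×n} be the arrowhead matrix A = [D u; v⋆ α], i.e., A_{kk} = d_k, A_{kn} = u_k, A_{nk} = conj(v_k) for k < n, A_{nn} = α, and A_{kl} = 0 otherwise, where d, u, v ∈ ℂ^{n−1} and α ∈ ℂ. If d_k ≠ 0 for all k = 1,…,n−1, then det(A) = (Π_{k=1}^{n−1} d_k) · (α − Σ_{k=1}^{n−1} conj(v_k) d_k^{−1} u_k). -/
/-- Determinant of a complex arrowhead matrix `A = [D u; v⋆ α]` (tip at the last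
position) when all diagonal entries of `D` are nonzero:
`det A = (∏ d_k) * (α - v⋆ D⁻¹ u)`.  The matrix has size `n+1` (so size at least `1`)
and the shaft data `d, u, v` lies in `ℂ^n`. -/
theorem arrow_det_nonzero_diag (n : ℕ) (d u v : Fin n → ℂ) (α : ℂ)
    (A : Matrix (Fin (n + 1)) (Fin (n + 1)) ℂ)
    (hdiag : ∀ k l : Fin n, A k.castSucc l.castSucc = if k = l then d k else 0)
    (hcol : ∀ k : Fin n, A k.castSucc (Fin.last n) = u k)
    (hrow : ∀ k : Fin n, A (Fin.last n) k.castSucc = star (v k))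
    (htip : A (Fin.last n) (Fin.last n) = α)
    (hd : ∀ k : Fin n, d k ≠ 0) :
    A.det = (∏ k, d k) * (α - ∑ k, star (v k) * (d k)⁻¹ * u k) := by
  have hA : A.submatrix (finSumFinEquiv (m := n) (n := 1)) finSumFinEquiv =
      Matrix.fromBlocks (Matrix.diagonal d) (Matrix.of fun k _ => u k)
        (Matrix.of fun _ k => star (v k)) (Matrix.of fun _ _ => α) := by
    have hlast : Fin.natAdd n (0 : Fin 1) = Fin.last n := rfl
    have hcast (k : Fin n) : Fin.castAdd 1 k = k.castSucc := rfl
    ext i j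
    rcases i with i | i <;> rcases j with j | j <;>
      simp [Fin.fin_one_eq_zero, hlast, hcast, hdiag, hcol, hrow, htip, Matrix.diagonal_apply]
  let : Invertible (Matrix.diagonal d) :=
    { invOf := Matrix.diagonal fun k => (d k)⁻¹
      invOf_mul_self := by simp [hd]
      mul_invOf_self := by simp [hd] }
  have hinv : ⅟(Matrix.diagonal d) = Matrix.diagonal fun k => (d k)⁻¹ := rfl
  rw [← Matrix.det_submatrix_equiv_self finSumFinEquiv A, hA, Matrix.det_fromBlocks₁₁,
    Matrix.det_diagonal, hinv, Matrix.det_fin_one]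
  simp [Matrix.mul_apply, Matrix.diagonal_apply]
end

section
/- Let n ≥ 1 and let A ∈ ℂ^{n×n} be the arrowhead matrix A = [D u; v⋆ α], i.e., A_{kk} = d_k, A_{kn} = u_k, A_{nk} = conj(v_k) for k < n, A_{nn} = α, and A_{kl} = 0 otherwise, where d, u, v ∈ ℂ^{n−1} and α ∈ ℂ. If d_i = 0 for some index i ∈ {1,…,n−1}, then det(A) = −(Π_{j=1}^{i−1} d_j) · conj(v_i) · (Π_{j=i+1}^{n−1} d_j) · u_i. -/
/-- Determinant of a complex arrowhead matrix `A = [D u; v⋆ α]` (tip at the last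
position) when some diagonal entry `d i` of `D` is zero:
`det A = -(∏_{j<i} d_j) ⬝ conj (v i) ⬝ (∏_{j>i} d_j) ⬝ u i`. -/
theorem arrow_det_zero_diag (n : ℕ) (d u v : Fin n → ℂ) (α : ℂ)
    (A : Matrix (Fin (n + 1)) (Fin (n + 1)) ℂ)
    (hdiag : ∀ k l : Fin n, A k.castSucc l.castSucc = if k = l then d k else 0)
    (hcol : ∀ k : Fin n, A k.castSucc (Fin.last n) = u k)
    (hrow : ∀ k : Fin n, A (Fin.last n) k.castSucc = star (v k))
    (htip : A (Fin.last n) (Fin.last n) = α)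
    (i : Fin n) (hdi : d i = 0) :
    A.det = -((∏ j ∈ Finset.Iio i, d j) * star (v i) * (∏ j ∈ Finset.Ioi i, d j) * u i) := by
  have hlast (k : Fin n) : k.castSucc ≠ Fin.last n := k.castSucc_lt_last.ne
  rw [Matrix.det_apply', Finset.sum_eq_single (Equiv.swap i.castSucc (Fin.last n))]
  · have hprod : ∏ k : Fin n, A (Equiv.swap i.castSucc (Fin.last n) k.castSucc) k.castSucc =
        star (v i) * ((∏ j ∈ Finset.Ioi i, d j) * ∏ j ∈ Finset.Iio i, d j) := by
      rw [Fintype.prod_eq_mul_prod_compl i, Equiv.swap_apply_left, hrow,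
        ← Finset.Ioi_disjUnion_Iio, Finset.prod_disjUnion]
      have hne (k : Fin n) (hk : k ≠ i) :
          A (Equiv.swap i.castSucc (Fin.last n) k.castSucc) k.castSucc = d k := by
        rw [Equiv.swap_apply_of_ne_of_ne (by simpa using hk) (hlast k), hdiag, if_pos rfl]
      congr 2
      · exact Finset.prod_congr rfl fun k hk ↦ hne k (Finset.mem_Ioi.mp hk).ne'
      · exact Finset.prod_congr rfl fun k hk ↦ hne k (Finset.mem_Iio.mp hk).ne
    rw [Fin.prod_univ_castSucc, hprod, Equiv.swap_apply_right, hcol,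
      Equiv.Perm.sign_swap (hlast i), Units.val_neg, Units.val_one]
    push_cast
    ring
  · intro σ _ hσ
    by_contra hzero
    have hfactor (j : Fin (n + 1)) : A (σ j) j ≠ 0 := fun hj ↦
      hzero (mul_eq_zero_of_right _ (Finset.prod_eq_zero (Finset.mem_univ j) hj))
    have hcorner (k l : Fin n) (h : σ l.castSucc = k.castSucc) : k = l ∧ l ≠ i := by
      have hkl := hfactor l.castSucc
      rw [h, hdiag] at hkl
      grind
    have hi : σ i.castSucc = Fin.last n := by
      rcases Fin.eq_castSucc_or_eq_last (σ i.castSucc) with ⟨k, hk⟩ | h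
      · exact absurd rfl (hcorner k i hk).2
      · exact h
    have hfix (l : Fin n) (hl : l ≠ i) : σ l.castSucc = l.castSucc := by
      rcases Fin.eq_castSucc_or_eq_last (σ l.castSucc) with ⟨k, hk⟩ | h
      · rw [hk, (hcorner k l hk).1]
      · exact absurd (Fin.castSucc_injective n (σ.injective (h.trans hi.symm))) hl
    have htop : σ (Fin.last n) = i.castSucc := by
      rcases Fin.eq_castSucc_or_eq_last (σ.symm i.castSucc) with ⟨l, hl⟩ | h
      · have hl' := hcorner i l (by rw [← hl, Equiv.apply_symm_apply])
        exact absurd hl'.1.symm hl'.2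
      · rw [← h, Equiv.apply_symm_apply]
    refine hσ (Equiv.ext fun j ↦ ?_)
    induction j using Fin.lastCases with
    | last => rw [htop, Equiv.swap_apply_right]
    | cast l =>
      rcases eq_or_ne l i with rfl | hl
      · rw [hi, Equiv.swap_apply_left]
      · rw [hfix l hl, Equiv.swap_apply_of_ne_of_ne (by simpa using hl) (hlast l)]
  · exact fun h ↦ absurd (Finset.mem_univ _) h
end

section
/- Let n ≥ 1, let i ∈ {1,…,n}, and let A ∈ ℍ^{n×n} be the arrowhead matrix with tip at position (i,i): A_{jj} = d_j for j < i, A_{jj} = d_{j−1} for j > i, A_{ji} = u_j for j < i, A_{ji} = u_{j−1} for j > i, A_{ij} = conj(v_j) for j < i, A_{ij} = conj(v_{j−1}) for j > i, A_{ii} = α, and zero elsewhere, where d, u, v ∈ ℍ^{n−1}, α ∈ ℍ. Assume d_k ≠ 0 for all k and that s := α − Σ_{k=1}^{n−1} conj(v_k) d_k^{−1} u_k ≠ 0, and set ρ = s^{−1}. Define the DPR1 matrix B ∈ ℍ^{n×n} by B_{kl} = Δ'_{kl} + x'_k ρ conj(y'_l), where Δ' is diagonal with Δ'_{jj} = d_j^{−1}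 for j < i, Δ'_{jj} = d_{j−1}^{−1} for j > i, Δ'_{ii} = 0; x'_j = d_j^{−1} u_j for j < i, x'_j = d_{j−1}^{−1} u_{j−1} for j > i, x'_i = −1; and y'_j = conj(d_j)^{−1} v_j for j < i, y'_j = conj(d_{j−1})^{−1} v_{j−1} for j > i, y'_i = −1. Then A B = I and B A = I, i.e., B is the inverse of A. -/
/-- Entrywise formulas for a right inverse of an arrowhead matrix with tip at `(i, i)`, nonzero
shaft diagonal `d`, and nonzero Schur complement `s`. -/
theorem arrowhead_mul_eq_one {K : Type*} [DivisionRing K] {n : ℕ} {i : Fin (n + 1)}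
    {d u w : Fin n → K} {α s : K} {A B : Matrix (Fin (n + 1)) (Fin (n + 1)) K}
    (hdiag : ∀ k l : Fin n, A (i.succAbove k) (i.succAbove l) = if k = l then d k else 0)
    (hcol : ∀ k, A (i.succAbove k) i = u k)
    (hrow : ∀ k, A i (i.succAbove k) = w k)
    (htip : A i i = α) (hd : ∀ k, d k ≠ 0)
    (hs : s = α - ∑ k, w k * (d k)⁻¹ * u k) (hs0 : s ≠ 0)
    (hBdiag : ∀ k l : Fin n, B (i.succAbove k) (i.succAbove l) =
      (if k = l then (d k)⁻¹ else 0) + (d k)⁻¹ * u k * s⁻¹ * (w l * (d l)⁻¹))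
    (hBcol : ∀ k, B (i.succAbove k) i = -((d k)⁻¹ * u k * s⁻¹))
    (hBrow : ∀ k, B i (i.succAbove k) = -(s⁻¹ * (w k * (d k)⁻¹)))
    (hBtip : B i i = s⁻¹) : A * B = 1 := by
  have hα : α = s + ∑ k, w k * (d k)⁻¹ * u k := by rw [hs]; abel
  ext k l
  rw [Matrix.mul_apply, Fin.sum_univ_succAbove _ i]
  rcases Fin.eq_self_or_eq_succAbove i k with hk | ⟨k, rfl⟩ <;>
    rcases Fin.eq_self_or_eq_succAbove i l with hl | ⟨l, rfl⟩
  · simp [hk, hl, htip, hBtip, hrow, hBcol, hα, add_mul, hs0, Finset.sum_mul, mul_assoc,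
      Matrix.one_apply]
  · simp [hk, htip, hBrow, hrow, hBdiag, hα, add_mul, mul_add, hs0, Finset.sum_mul, mul_assoc,
      Finset.sum_add_distrib, (Fin.succAbove_ne i l).symm]
  · simp [hl, hcol, hBtip, hdiag, hBcol, mul_assoc, hd, Fin.succAbove_ne]
  · simp [hcol, hBrow, hdiag, hBdiag, mul_assoc, mul_add, Finset.sum_add_distrib,
      Matrix.one_apply, hd]
    split_ifs with hkl
    · rw [hkl, mul_inv_cancel₀ (hd l)]
    · rfl

/-- The inverse of a nonsingular quaternionic arrowhead matrix with tip at position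
`(i,i)` and all shaft diagonal entries nonzero is the DPR1 matrix
`DPR1(Δ', x', y', ρ)` with `Δ' = P [D⁻¹ 0; 0 0] Pᵀ`, `x' = P [D⁻¹u; -1]`,
`y' = P [D⁻⋆v; -1]`, `ρ = (α - v⋆ D⁻¹ u)⁻¹`.  The matrix has size `n+1`; positions
different from the tip `i` are enumerated by `i.succAbove : Fin n → Fin (n+1)`
(this encodes the permutation `P`). -/
theorem arrow_inv_nonzero_diag (n : ℕ) (i : Fin (n + 1))
    (d u v : Fin n → Quaternion ℝ) (α : Quaternion ℝ)
    (A : Matrix (Fin (n + 1)) (Fin (n + 1)) (Quaternion ℝ))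
    (hdiag : ∀ k l : Fin n, A (i.succAbove k) (i.succAbove l) = if k = l then d k else 0)
    (hcol : ∀ k : Fin n, A (i.succAbove k) i = u k)
    (hrow : ∀ k : Fin n, A i (i.succAbove k) = star (v k))
    (htip : A i i = α)
    (hd : ∀ k : Fin n, d k ≠ 0)
    (s : Quaternion ℝ) (hs : s = α - ∑ k, star (v k) * (d k)⁻¹ * u k) (hs0 : s ≠ 0)
    (ρ : Quaternion ℝ) (hρ : ρ = s⁻¹)
    (Δ' x' y' : Fin (n + 1) → Quaternion ℝ)
    (hΔ'1 : ∀ k : Fin n, Δ' (i.succAbove k) = (d k)⁻¹) (hΔ'2 : Δ' i = 0)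
    (hx'1 : ∀ k : Fin n, x' (i.succAbove k) = (d k)⁻¹ * u k) (hx'2 : x' i = -1)
    (hy'1 : ∀ k : Fin n, y' (i.succAbove k) = (star (d k))⁻¹ * v k) (hy'2 : y' i = -1)
    (B : Matrix (Fin (n + 1)) (Fin (n + 1)) (Quaternion ℝ))
    (hB : ∀ k l : Fin (n + 1), B k l = (if k = l then Δ' k else 0) + x' k * ρ * star (y' l)) :
    A * B = 1 ∧ B * A = 1 := by
  have hstar (k : Fin n) : star ((star (d k))⁻¹ * v k) = star (v k) * (d k)⁻¹ := by
    rw [star_mul, star_inv₀, star_star]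
  subst hρ
  have hAB : A * B = 1 := by
    refine arrowhead_mul_eq_one hdiag hcol hrow htip hd hs hs0 ?_ ?_ ?_ ?_ <;> intros <;>
      simp [hB, hΔ'1, hΔ'2, hx'1, hx'2, hy'1, hy'2, hstar, Fin.succAbove_ne,
        -star_mul]
  exact ⟨hAB, mul_eq_one_symm hAB⟩
end

section
/- Let n ≥ 2 and let A ∈ ℍ^{n×n} be the arrowhead matrix with tip at the last position: A_{kk} = d_k, A_{kn} = u_k, A_{nk} = conj(v_k) for k < n, A_{nn} = α, and zero elsewhere, where d, u, v ∈ ℍ^{n−1}, α ∈ ℍ. Assume d_j = 0 for some j ∈ {1,…,n−1}, d_k ≠ 0 for all k ≠ j, u_j ≠ 0, and v_j ≠ 0. Define B ∈ ℍ^{n×n} by: B_{kk} = d_k^{−1} for k ∉ {j, n}; B_{nn} = 0; B_{kj} = −d_k^{−1} u_k u_j^{−1} for k ∉ {j, n}; B_{nj} = u_j^{−1}; B_{jk} = −conj(v_j)^{−1} conj(v_k) d_k^{−1} for k ∉ {j, n}; B_{jn} = conj(v_j)^{−1}; B_{jj} = conj(v_j)^{−1} · (−α + Σ_{k≠j, k<n}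 conj(v_k) d_k^{−1} u_k) · u_j^{−1}; and B_{kl} = 0 otherwise. Then A B = I and B A = I; in particular the inverse of A is an arrowhead matrix with the tip of the arrow at position (j,j) and zero at position (n,n). -/
/-- Inverse of a nonsingular quaternionic arrowhead matrix with tip at the last
position when exactly one shaft diagonal entry `d j` is zero: the inverse is an
arrowhead matrix with the tip of the arrow at position `(j,j)` and a zero at the
last diagonal position.  The matrix has size `n+1` with `n ≥ 1` (i.e. size at
least `2`), and the shaft data `d, u, v` lies in `ℍ^n`. -/
theorem arrow_inv_zero_diag (n : ℕ) (hn : 1 ≤ n)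
    (d u v : Fin n → Quaternion ℝ) (α : Quaternion ℝ)
    (A : Matrix (Fin (n + 1)) (Fin (n + 1)) (Quaternion ℝ))
    (hdiag : ∀ k l : Fin n, A k.castSucc l.castSucc = if k = l then d k else 0)
    (hcol : ∀ k : Fin n, A k.castSucc (Fin.last n) = u k)
    (hrow : ∀ k : Fin n, A (Fin.last n) k.castSucc = star (v k))
    (htip : A (Fin.last n) (Fin.last n) = α)
    (j : Fin n) (hdj : d j = 0) (hd : ∀ k : Fin n, k ≠ j → d k ≠ 0)
    (huj : u j ≠ 0) (hvj : v j ≠ 0)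
    (B : Matrix (Fin (n + 1)) (Fin (n + 1)) (Quaternion ℝ))
    (hB1 : ∀ k : Fin n, k ≠ j → B k.castSucc k.castSucc = (d k)⁻¹)
    (hB2 : B (Fin.last n) (Fin.last n) = 0)
    (hB3 : ∀ k : Fin n, k ≠ j → B k.castSucc j.castSucc = -((d k)⁻¹ * u k * (u j)⁻¹))
    (hB4 : B (Fin.last n) j.castSucc = (u j)⁻¹)
    (hB5 : ∀ k : Fin n, k ≠ j → B j.castSucc k.castSucc = -((star (v j))⁻¹ * star (v k) * (d k)⁻¹))
    (hB6 : B j.castSucc (Fin.last n) = (star (v j))⁻¹)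
    (hB7 : B j.castSucc j.castSucc =
      (star (v j))⁻¹ * (-α + ∑ k ∈ Finset.univ.erase j, star (v k) * (d k)⁻¹ * u k) * (u j)⁻¹)
    (hB8 : ∀ k l : Fin n, k ≠ j → l ≠ j → k ≠ l → B k.castSucc l.castSucc = 0)
    (hB9 : ∀ k : Fin n, k ≠ j → B k.castSucc (Fin.last n) = 0)
    (hB10 : ∀ k : Fin n, k ≠ j → B (Fin.last n) k.castSucc = 0) :
    A * B = 1 ∧ B * A = 1 := by
  have hw : star (v j) ≠ 0 := star_ne_zero.mpr hvj
  have hshaft : ∀ (k : Fin n) (l : Fin (n + 1)),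
      (A * B) k.castSucc l = d k * B k.castSucc l + u k * B (Fin.last n) l := fun k l => by
    simp [Matrix.mul_apply, Fin.sum_univ_castSucc, hdiag, hcol]
  have hlast : ∀ l : Fin (n + 1), (A * B) (Fin.last n) l =
      star (v j) * B j.castSucc l + ∑ k ∈ Finset.univ.erase j, star (v k) * B k.castSucc l
        + α * B (Fin.last n) l := fun l => by
    simp only [Matrix.mul_apply, Fin.sum_univ_castSucc, hrow, htip]
    rw [Finset.add_sum_erase _ (fun k => star (v k) * B k.castSucc l) (Finset.mem_univ j)]
  have hAB : A * B = 1 := by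
    ext1 k l
    induction k using Fin.lastCases with
    | last =>
      rw [hlast]
      induction l using Fin.lastCases with
      | last =>
        rw [Finset.sum_eq_zero fun k hk => by rw [hB9 k (Finset.ne_of_mem_erase hk), mul_zero]]
        simp [hB2, hB6, hw]
      | cast l =>
        rw [Matrix.one_apply_ne (Fin.castSucc_ne_last l).symm]
        obtain rfl | hl := eq_or_ne l j
        · have hsum : ∑ k ∈ Finset.univ.erase l, star (v k) * B k.castSucc l.castSucc =
              -((∑ k ∈ Finset.univ.erase l, star (v k) * (d k)⁻¹ * u k) * (u l)⁻¹) := by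
            rw [Finset.sum_mul, ← Finset.sum_neg_distrib]
            refine Finset.sum_congr rfl fun k hk => ?_
            rw [hB3 k (Finset.ne_of_mem_erase hk)]
            simp only [mul_neg, mul_assoc]
          rw [hsum, hB4, hB7, mul_assoc (star (v l))⁻¹, mul_inv_cancel_left₀ hw]
          noncomm_ring
        · rw [Finset.sum_eq_single_of_mem l (by simp [hl]) fun k hk hkl => by
            rw [hB8 k l (Finset.ne_of_mem_erase hk) hl hkl, mul_zero]]
          rw [hB1 l hl, hB5 l hl, hB10 l hl, mul_neg, mul_assoc (star (v j))⁻¹,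
            mul_inv_cancel_left₀ hw]
          simp
    | cast k =>
      rw [hshaft]
      induction l using Fin.lastCases with
      | last =>
        rw [Matrix.one_apply_ne (Fin.castSucc_ne_last k), hB2]
        obtain rfl | hk := eq_or_ne k j
        · simp [hdj]
        · simp [hB9 k hk]
      | cast l =>
        obtain rfl | hk := eq_or_ne k j
        · obtain rfl | hl := eq_or_ne l k
          · simp [hdj, hB4, huj]
          · simp [hdj, hB10 l hl, hl.symm]
        · obtain rfl | hl := eq_or_ne l j
          · rw [hB3 k hk, hB4, mul_neg, mul_assoc (d k)⁻¹, mul_inv_cancel_left₀ (hd k hk)]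
            simp [hk]
          · obtain rfl | hkl := eq_or_ne k l
            · simp [hB1 k hk, hB10 k hk, hd k hk]
            · simp [hB8 k l hk hl hkl, hB10 l hl, hkl]
  exact ⟨hAB, mul_eq_one_symm hAB⟩
end

section
/- Let A = Δ + x ρ y⋆ ∈ ℍ^{n×n} be the DPR1 matrix with entries A_{kl} = δ_k [k=l] + x_k ρ conj(y_l), where δ ∈ ℍ^n gives the diagonal of Δ, x, y ∈ ℍ^n, ρ ∈ ℍ. Assume δ_k ≠ 0 for all k and that t := 1 + (Σ_{k=1}^{n} conj(y_k) δ_k^{−1} x_k) ρ ≠ 0, and set ρ' = −ρ t^{−1}. Define B ∈ ℍ^{n×n} by B_{kl} = δ_k^{−1} [k=l] + (δ_k^{−1} x_k) ρ' conj(conj(δ_l)^{−1} y_l). Then A B = I and B A = I; i.e., the inverse of A is the DPR1 matrix DPR1(Δ^{−1}, Δ^{−1}x, Δ^{−⋆}y, −ρ(1 + y⋆Δ^{−1}xρ)^{−1}). -/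
open Matrix in
/-- Entries of the product of two rank-one perturbations of diagonal matrices over a ring. -/
theorem Matrix.diagonal_add_vecMulVec_mul_apply {R m : Type*} [Ring R] [Fintype m] [DecidableEq m]
    (a b u z v w : m → R) (k l : m) :
    ((diagonal a + vecMulVec u z) * (diagonal b + vecMulVec v w) : Matrix m m R) k l =
      (if k = l then a k * b k else 0) + a k * (v k * w l) + u k * z l * b l
        + u k * (∑ j, z j * v j) * w l := by
  have h : (vecMulVec u z * vecMulVec v w : Matrix m m R) k l = u k * (∑ j, z j * v j) * w l := by
    simp only [mul_apply, vecMulVec_apply, Finset.mul_sum, Finset.sum_mul, mul_assoc]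
  rw [add_mul, mul_add, mul_add, add_apply, add_apply, add_apply, h, diagonal_mul_diagonal,
    diagonal_mul, mul_diagonal, diagonal_apply, vecMulVec_apply, vecMulVec_apply]
  abel

/-- Inverse of a nonsingular quaternionic DPR1 matrix `A = Δ + x ρ y⋆` with all
diagonal entries of `Δ` nonzero: the inverse is the DPR1 matrix
`DPR1(Δ⁻¹, Δ⁻¹x, Δ⁻⋆y, -ρ (1 + y⋆ Δ⁻¹ x ρ)⁻¹)`. -/
theorem dpr1_inv_nonzero_diag (n : ℕ) (δ x y : Fin n → Quaternion ℝ) (ρ : Quaternion ℝ)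
    (A : Matrix (Fin n) (Fin n) (Quaternion ℝ))
    (hA : ∀ k l : Fin n, A k l = (if k = l then δ k else 0) + x k * ρ * star (y l))
    (hδ : ∀ k : Fin n, δ k ≠ 0)
    (t : Quaternion ℝ) (ht : t = 1 + (∑ k, star (y k) * (δ k)⁻¹ * x k) * ρ) (ht0 : t ≠ 0)
    (ρ' : Quaternion ℝ) (hρ' : ρ' = -ρ * t⁻¹)
    (B : Matrix (Fin n) (Fin n) (Quaternion ℝ))
    (hB : ∀ k l : Fin n, B k l =
      (if k = l then (δ k)⁻¹ else 0) + ((δ k)⁻¹ * x k) * ρ' * star ((star (δ l))⁻¹ * y l)) :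
    A * B = 1 ∧ B * A = 1 := by
  set s := ∑ k, star (y k) * (δ k)⁻¹ * x k with hs
  have hright : ρ + ρ' + ρ * s * ρ' = 0 := by
    have h : ρ' + ρ * s * ρ' = -(ρ * (t * t⁻¹)) := by
      rw [hρ', ← mul_assoc ρ t, ht]; noncomm_ring
    rw [add_assoc, h, mul_inv_cancel₀ ht0, mul_one, add_neg_cancel]
  have hleft : ρ + ρ' + ρ' * s * ρ = 0 := by
    have h : ρ' + ρ' * s * ρ = ρ' * t := by rw [ht]; noncomm_ring
    rw [add_assoc, h, hρ', mul_assoc, inv_mul_cancel₀ ht0, mul_one, add_neg_cancel]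
  have hA' : A = Matrix.diagonal δ + Matrix.vecMulVec (fun k => x k * ρ) (fun l => star (y l)) := by
    ext1 k l
    rw [hA, Matrix.add_apply, Matrix.diagonal_apply, Matrix.vecMulVec_apply]
  have hB' : B = Matrix.diagonal (fun k => (δ k)⁻¹) +
      Matrix.vecMulVec (fun k => (δ k)⁻¹ * x k * ρ') (fun l => star (y l) * (δ l)⁻¹) := by
    ext1 k l
    rw [hB, Matrix.add_apply, Matrix.diagonal_apply, Matrix.vecMulVec_apply, star_mul, star_inv₀,
      star_star]
  have hsρ' : ∑ j, star (y j) * ((δ j)⁻¹ * x j * ρ') = s * ρ' := by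
    simp only [hs, Finset.sum_mul, mul_assoc]
  have hsρ : ∑ j, star (y j) * (δ j)⁻¹ * (x j * ρ) = s * ρ := by
    simp only [hs, Finset.sum_mul, mul_assoc]
  constructor
  · ext1 k l
    rw [hA', hB', Matrix.diagonal_add_vecMulVec_mul_apply, hsρ', mul_inv_cancel₀ (hδ k),
      Matrix.one_apply, add_assoc, add_assoc, add_eq_left]
    calc _ = (δ k * (δ k)⁻¹) * x k * ρ' * (star (y l) * (δ l)⁻¹) +
          (x k * ρ * star (y l) * (δ l)⁻¹ + x k * ρ * (s * ρ') * (star (y l) * (δ l)⁻¹)) := by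
            simp only [mul_assoc]
      _ = x k * (ρ + ρ' + ρ * s * ρ') * (star (y l) * (δ l)⁻¹) := by
            rw [mul_inv_cancel₀ (hδ k)]; noncomm_ring
      _ = 0 := by rw [hright, mul_zero, zero_mul]
  · ext1 k l
    rw [hA', hB', Matrix.diagonal_add_vecMulVec_mul_apply, hsρ, inv_mul_cancel₀ (hδ k),
      Matrix.one_apply, add_assoc, add_assoc, add_eq_left]
    calc _ = (δ k)⁻¹ * (x k * ρ * star (y l)) +
          ((δ k)⁻¹ * x k * ρ' * star (y l) * ((δ l)⁻¹ * δ l) +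
            (δ k)⁻¹ * x k * ρ' * (s * ρ) * star (y l)) := by
            simp only [mul_assoc]
      _ = (δ k)⁻¹ * x k * (ρ + ρ' + ρ' * s * ρ) * star (y l) := by
            rw [inv_mul_cancel₀ (hδ l)]; noncomm_ring
      _ = 0 := by rw [hleft, mul_zero, zero_mul]
end

section
/- Let A = Δ + x ρ y⋆ ∈ ℍ^{n×n} be the DPR1 matrix with entries A_{kl} = δ_k [k=l] + x_k ρ conj(y_l), where δ ∈ ℍ^n gives the diagonal of Δ, x, y ∈ ℍ^n, ρ ∈ ℍ. Assume δ_j = 0 for some j ∈ {1,…,n}, δ_k ≠ 0 for all k ≠ j, x_j ≠ 0, y_j ≠ 0, and ρ ≠ 0. Define B ∈ ℍ^{n×n} by: B_{kk} = δ_k^{−1} for k ≠ j; B_{kj} = −δ_k^{−1} x_k x_j^{−1} for k ≠ j; B_{jk} = −conj(y_j)^{−1} conj(y_k) δ_k^{−1} for k ≠ j; B_{jj} = conj(y_j)^{−1} · (ρ^{−1} + Σ_{k≠j} conj(y_k) δ_k^{−1} x_k) · x_j^{−1}; and B_{kl} = 0 otherwise. Then A B = I and B A = I; in particular the inverse of A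 is an arrowhead matrix with the tip of the arrow at position (j,j). -/
/-- Right inverse of the matrix `Δ + x ρ z`, with exactly one diagonal entry `δ j` of `Δ` zero,
over a division ring. -/
theorem mul_arrowhead_eq_one {K ι : Type*} [DivisionRing K] [Fintype ι] [DecidableEq ι]
    (δ x z : ι → K) (ρ : K) (A B : Matrix ι ι K)
    (hA : ∀ k l, A k l = (if k = l then δ k else 0) + x k * ρ * z l)
    (j : ι) (hδj : δ j = 0) (hδ : ∀ k, k ≠ j → δ k ≠ 0)
    (hxj : x j ≠ 0) (hzj : z j ≠ 0) (hρ : ρ ≠ 0)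
    (hB1 : ∀ k, k ≠ j → B k k = (δ k)⁻¹)
    (hB2 : ∀ k, k ≠ j → B k j = -((δ k)⁻¹ * x k * (x j)⁻¹))
    (hB3 : ∀ k, k ≠ j → B j k = -((z j)⁻¹ * z k * (δ k)⁻¹))
    (hB4 : B j j = (z j)⁻¹ * (ρ⁻¹ + ∑ k ∈ Finset.univ.erase j, z k * (δ k)⁻¹ * x k) * (x j)⁻¹)
    (hB5 : ∀ k l, k ≠ j → l ≠ j → k ≠ l → B k l = 0) :
    A * B = 1 := by
  have hAB (k l : ι) : (A * B) k l = δ k * B k l + x k * ρ * ∑ m, z m * B m l := by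
    simp [Matrix.mul_apply, hA, add_mul, Finset.sum_add_distrib, Finset.mul_sum, mul_assoc]
  have hcol (l : ι) (hl : l ≠ j) : ∑ m, z m * B m l = 0 := by
    rw [Fintype.sum_eq_add l j hl fun m hm => by rw [hB5 m l hm.2 hl hm.1, mul_zero],
      hB1 l hl, hB3 l hl]
    simp [mul_assoc, mul_inv_cancel_left₀ hzj]
  have htip : ∑ m, z m * B m j = ρ⁻¹ * (x j)⁻¹ := by
    have hsum : ∑ m ∈ Finset.univ.erase j, z m * B m j =
        -((∑ m ∈ Finset.univ.erase j, z m * (δ m)⁻¹ * x m) * (x j)⁻¹) := by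
      rw [Finset.sum_mul, ← Finset.sum_neg_distrib]
      refine Finset.sum_congr rfl fun m hm => ?_
      rw [hB2 m (Finset.ne_of_mem_erase hm)]
      simp [mul_assoc]
    rw [← Finset.add_sum_erase _ _ (Finset.mem_univ j), hsum, hB4, mul_assoc (z j)⁻¹,
      mul_inv_cancel_left₀ hzj, add_mul, add_neg_cancel_right]
  ext k l
  rw [hAB]
  by_cases hl : l = j
  · subst l
    rw [htip, mul_assoc, mul_inv_cancel_left₀ hρ]
    by_cases hk : k = j
    · subst k
      simp [hδj, hxj]
    · rw [hB2 k hk, Matrix.one_apply_ne hk, mul_neg, mul_assoc (δ k)⁻¹,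
        mul_inv_cancel_left₀ (hδ k hk), neg_add_cancel]
  · rw [hcol l hl, mul_zero, add_zero]
    by_cases hkl : k = l
    · subst k
      rw [hB1 l hl, mul_inv_cancel₀ (hδ l hl), Matrix.one_apply_eq]
    · rw [Matrix.one_apply_ne hkl]
      by_cases hk : k = j
      · rw [hk, hδj, zero_mul]
      · rw [hB5 k l hk hl hkl, mul_zero]

/-- Inverse of a nonsingular quaternionic DPR1 matrix `A = Δ + x ρ y⋆` when exactly
one diagonal entry `δ j` of `Δ` is zero: the inverse is an arrowhead matrix with the
tip of the arrow at position `(j,j)`. -/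
theorem dpr1_inv_zero_diag (n : ℕ) (δ x y : Fin n → Quaternion ℝ) (ρ : Quaternion ℝ)
    (A : Matrix (Fin n) (Fin n) (Quaternion ℝ))
    (hA : ∀ k l : Fin n, A k l = (if k = l then δ k else 0) + x k * ρ * star (y l))
    (j : Fin n) (hδj : δ j = 0) (hδ : ∀ k : Fin n, k ≠ j → δ k ≠ 0)
    (hxj : x j ≠ 0) (hyj : y j ≠ 0) (hρ : ρ ≠ 0)
    (B : Matrix (Fin n) (Fin n) (Quaternion ℝ))
    (hB1 : ∀ k : Fin n, k ≠ j → B k k = (δ k)⁻¹)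
    (hB2 : ∀ k : Fin n, k ≠ j → B k j = -((δ k)⁻¹ * x k * (x j)⁻¹))
    (hB3 : ∀ k : Fin n, k ≠ j → B j k = -((star (y j))⁻¹ * star (y k) * (δ k)⁻¹))
    (hB4 : B j j =
      (star (y j))⁻¹ * (ρ⁻¹ + ∑ k ∈ Finset.univ.erase j, star (y k) * (δ k)⁻¹ * x k) * (x j)⁻¹)
    (hB5 : ∀ k l : Fin n, k ≠ j → l ≠ j → k ≠ l → B k l = 0) :
    A * B = 1 ∧ B * A = 1 := by
  have hAB : A * B = 1 :=
    mul_arrowhead_eq_one δ x (fun k => star (y k)) ρ A B hA j hδj hδ hxj (star_ne_zero.mpr hyj) hρ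
      hB1 hB2 hB3 hB4 hB5
  exact ⟨hAB, mul_eq_one_symm hAB⟩
end
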